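/- Under the hypotheses of the strong transversality result for sub-Gaussian measures (μ = e^{−Φ} L^{2N} × H^N⌞E with Φ satisfying β₀‖y − z‖² + Φ(y) ≥ c(‖y‖² + ‖z‖²) − b for y ∈ Z, z ∈ E; Ψ(ξ,η) := Φ(ξ+η) continuously differentiable in η with ‖D₂Ψ(ξ,η)‖ ≤ C(1 + u(ξ) + ‖η‖^γ) where ∫_E u(ξ)e^{−c‖ξ‖²/4} dH^N(ξ) < ∞), there is a constant C₁ > 0 such that for all sufficiently large β, ‖μ_β − μ_∞‖_FN ≤ C₁ β^{−1/2}, where μ_∞ is the diagonal concentration defined by ∫ f dμ_∞ = ∫_E f(ξ,ξ) e^{−Φ(ξ)} dH^N(ξ). -/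

import Mathlib

open MeasureTheory Real Filter Topology

noncomputable section

/-- Phase space `Z`, identified with `ℝ^{2N}` (with Lebesgue measure `volume`). -/
abbrev ZZ (N : ℕ) := EuclideanSpace ℝ (Fin (2 * N))

/-- The normalization constant `B_β = ∫_Z exp(−β‖ξ‖²) dL^{2N}(ξ)`. -/
def Bconst (N : ℕ) (β : ℝ) : ℝ := ∫ ξ : ZZ N, Real.exp (-β * ‖ξ‖ ^ 2)

/-- The thermalization `μ_β := w_β · μ` with `w_β(y,z) = B_β⁻¹ exp(−β‖y−z‖²)`. -/
def therm {N : ℕ} (μ : Measure (ZZ N × ZZ N)) (β : ℝ) : Measure (ZZ N × ZZ N) :=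
  μ.withDensity fun q => ENNReal.ofReal ((Bconst N β)⁻¹ * Real.exp (-β * ‖q.1 - q.2‖ ^ 2))

/-- The deterministic physical likelihood `μ_E = H^N ⌞ E`. -/
def muE (N : ℕ) (E : AffineSubspace ℝ (ZZ N)) : Measure (ZZ N) :=
  (μH[(N : ℝ)]).restrict (E : Set (ZZ N))

/-- The sub-Gaussian material likelihood `μ_D = e^{−Φ} L^{2N}`. -/
def muD (N : ℕ) (Φ : ZZ N → ℝ) : Measure (ZZ N) :=
  volume.withDensity fun y => ENNReal.ofReal (Real.exp (-Φ y))

/-- `H^N ⌞ E` is the image of the Hausdorff measure on the direction of `E` under a translation. -/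
lemma muE_eq_map {N : ℕ} {E : AffineSubspace ℝ (ZZ N)} {p : ZZ N} (hp : p ∈ E) :
    muE N E = Measure.map (fun v : E.direction => (v : ZZ N) + p) μH[(N : ℝ)] := by
  have hiso : Isometry (fun v : E.direction => (v : ZZ N) + p) :=
    Isometry.of_dist_eq fun v w => by simp [Subtype.dist_eq]
  rw [hiso.map_hausdorffMeasure (Or.inl (Nat.cast_nonneg N)), muE]
  congr 1
  ext x
  constructor
  · intro hx
    exact ⟨⟨x - p, AffineSubspace.vsub_mem_direction hx hp⟩, by simp⟩
  · rintro ⟨v, rfl⟩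
    exact AffineSubspace.vadd_mem_of_mem_direction v.2 hp

lemma isAddHaarMeasure_direction {N : ℕ} {E : AffineSubspace ℝ (ZZ N)}
    (hdim : Module.finrank ℝ E.direction = N) :
    (μH[(N : ℝ)] : Measure E.direction).IsAddHaarMeasure := by
  have h := MeasureTheory.isAddHaarMeasure_hausdorffMeasure (E := E.direction)
  rwa [hdim] at h

lemma sFinite_muE {N : ℕ} {E : AffineSubspace ℝ (ZZ N)} (hE : (E : Set (ZZ N)).Nonempty)
    (hdim : Module.finrank ℝ E.direction = N) : SFinite (muE N E) := by
  obtain ⟨p, hp⟩ := hE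
  have := isAddHaarMeasure_direction hdim
  rw [muE_eq_map hp]
  infer_instance

lemma map_sub_muE {N : ℕ} {E : AffineSubspace ℝ (ZZ N)} (hE : (E : Set (ZZ N)).Nonempty)
    (hdim : Module.finrank ℝ E.direction = N) (v : E.direction) :
    Measure.map (fun x => x - (v : ZZ N)) (muE N E) = muE N E := by
  obtain ⟨p, hp⟩ := hE
  have := isAddHaarMeasure_direction hdim
  rw [muE_eq_map hp, Measure.map_map (by fun_prop) (by fun_prop)]
  conv_rhs => rw [← map_sub_right_eq_self (μH[(N : ℝ)] : Measure E.direction) v,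
    Measure.map_map (by fun_prop) (by fun_prop)]
  congr 1
  ext1 w
  simp only [Function.comp_apply, Submodule.coe_sub]
  abel

lemma integrable_exp_neg_mul_sq_norm {V : Type*} [NormedAddCommGroup V] [InnerProductSpace ℝ V]
    [FiniteDimensional ℝ V] [MeasurableSpace V] [BorelSpace V] (μ : Measure V)
    [μ.IsAddHaarMeasure] {a : ℝ} (ha : 0 < a) :
    Integrable (fun v : V => Real.exp (-a * ‖v‖ ^ 2)) μ := by
  have h : Integrable (fun v : V => Real.exp (-a * ‖v‖ ^ 2)) := by
    have := (GaussianFourier.integrable_cexp_neg_mul_sq_norm_add (V := V) (b := (a : ℂ))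
      (by simpa using ha) 0 0).re
    refine this.congr (ae_of_all _ fun v => ?_)
    have e : (-(a : ℂ) * (‖v‖ : ℂ) ^ 2 + 0 * (inner ℝ (0 : V) v : ℂ))
        = ((-a * ‖v‖ ^ 2 : ℝ) : ℂ) := by push_cast; ring
    simp only [e, RCLike.re_to_complex, Complex.exp_ofReal_re]
  rw [Measure.isAddLeftInvariant_eq_smul μ volume]
  exact h.smul_measure_nnreal

lemma integrable_exp_neg_mul_sq_norm_muE {N : ℕ} {E : AffineSubspace ℝ (ZZ N)}
    (hE : (E : Set (ZZ N)).Nonempty) (hdim : Module.finrank ℝ E.direction = N)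
    {a : ℝ} (ha : 0 < a) :
    Integrable (fun z : ZZ N => Real.exp (-a * ‖z‖ ^ 2)) (muE N E) := by
  obtain ⟨p, hp⟩ := hE
  have := isAddHaarMeasure_direction hdim
  rw [muE_eq_map hp, integrable_map_measure (by fun_prop) (by fun_prop)]
  refine ((integrable_exp_neg_mul_sq_norm (μH[(N : ℝ)] : Measure E.direction)
    (half_pos ha)).const_mul (Real.exp (a * ‖p‖ ^ 2))).mono' (by fun_prop)
    (ae_of_all _ fun v => ?_)
  rw [Function.comp_apply, Real.norm_of_nonneg (Real.exp_pos _).le, ← Real.exp_add]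
  refine Real.exp_le_exp.2 ?_
  have h1 : ‖v‖ ≤ ‖(v : ZZ N) + p‖ + ‖p‖ := by
    simpa using norm_sub_le ((v : ZZ N) + p) p
  have h2 : ‖v‖ ^ 2 ≤ 2 * ‖(v : ZZ N) + p‖ ^ 2 + 2 * ‖p‖ ^ 2 := by
    nlinarith [sq_nonneg (‖(v : ZZ N) + p‖ - ‖p‖), norm_nonneg v]
  nlinarith

/-- The change of variables `(ζ, ξ) ↦ (ξ + Q ζ, ξ - P ζ)`, with `P` and `Q` the orthogonal
projections onto the direction of `E` and its complement, preserves `L^{2N} × H^N ⌞ E`. -/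
lemma measurePreserving_shear {N : ℕ} {E : AffineSubspace ℝ (ZZ N)}
    (hE : (E : Set (ZZ N)).Nonempty) (hdim : Module.finrank ℝ E.direction = N) :
    MeasurePreserving
      (fun q : ZZ N × ZZ N => (q.2 + (E.directionᗮ.orthogonalProjectionOnto q.1 : ZZ N),
        q.2 - (E.direction.orthogonalProjectionOnto q.1 : ZZ N)))
      (volume.prod (muE N E)) (volume.prod (muE N E)) := by
  have := sFinite_muE hE hdim
  have h1 : MeasurePreserving
      (fun q : ZZ N × ZZ N => (q.1, q.2 - (E.direction.orthogonalProjectionOnto q.1 : ZZ N)))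
      (volume.prod (muE N E)) (volume.prod (muE N E)) :=
    (MeasurePreserving.id volume).skew_product
      (g := fun ζ ξ => ξ - (E.direction.orthogonalProjectionOnto ζ : ZZ N)) (by fun_prop)
      (ae_of_all _ fun ζ => map_sub_muE hE hdim _)
  convert (measurePreserving_add_prod (volume : Measure (ZZ N)) (muE N E)).comp h1 using 1
  ext1 q
  refine Prod.ext ?_ rfl
  have h := E.direction.starProjection_add_starProjection_orthogonal q.1
  simp only [Submodule.starProjection_apply] at h
  simp only [Function.comp_apply]
  nth_rewrite 2 [← h]
  abel

lemma exists_mul_one_add_rpow_le_exp {γ : ℝ} (hγ : 0 ≤ γ) :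
    ∃ K : ℝ, ∀ x : ℝ, 0 ≤ x → x * (1 + x ^ γ) ≤ K * Real.exp (x ^ 2 / 4) := by
  set n := ⌈γ⌉₊
  refine ⟨(2 + (n + 1).factorial) * Real.exp 1, fun x hx => ?_⟩
  have h1 : x ^ γ ≤ 1 + x ^ n := by
    rcases le_total x 1 with h | h
    · have := Real.rpow_le_one hx h hγ
      have := pow_nonneg hx n
      linarith
    · have := Real.rpow_le_rpow_of_exponent_le h (Nat.le_ceil γ)
      rw [Real.rpow_natCast] at this
      linarith
  have h2 : x ≤ Real.exp x := by linarith [Real.add_one_le_exp x]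
  have h3 : x ^ (n + 1) ≤ (n + 1).factorial * Real.exp x := by
    have := Real.pow_div_factorial_le_exp x hx (n + 1)
    rwa [div_le_iff₀' (by positivity)] at this
  have h4 : Real.exp x ≤ Real.exp 1 * Real.exp (x ^ 2 / 4) := by
    rw [← Real.exp_add]
    exact Real.exp_le_exp.2 (by nlinarith [sq_nonneg (x - 2)])
  calc x * (1 + x ^ γ) ≤ x * (2 + x ^ n) :=
        mul_le_mul_of_nonneg_left (by linarith) hx
    _ = 2 * x + x ^ (n + 1) := by ring
    _ ≤ (2 + (n + 1).factorial) * Real.exp x := by linarith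
    _ ≤ (2 + (n + 1).factorial) * (Real.exp 1 * Real.exp (x ^ 2 / 4)) := by gcongr
    _ = _ := by ring

lemma integrable_mul_one_add_rpow_mul_exp {V : Type*} [NormedAddCommGroup V]
    [InnerProductSpace ℝ V] [FiniteDimensional ℝ V] [MeasurableSpace V] [BorelSpace V]
    {γ : ℝ} (hγ : 0 ≤ γ) :
    Integrable (fun s : V => ‖s‖ * (1 + ‖s‖ ^ γ) * Real.exp (-‖s‖ ^ 2 / 2)) := by
  obtain ⟨K, hK⟩ := exists_mul_one_add_rpow_le_exp hγ
  refine ((integrable_exp_neg_mul_sq_norm (volume : Measure V)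
    (a := 1 / 4) (by norm_num)).const_mul K).mono' (by fun_prop) (ae_of_all _ fun s => ?_)
  rw [Real.norm_of_nonneg (by positivity)]
  calc ‖s‖ * (1 + ‖s‖ ^ γ) * Real.exp (-‖s‖ ^ 2 / 2)
      ≤ K * Real.exp (‖s‖ ^ 2 / 4) * Real.exp (-‖s‖ ^ 2 / 2) :=
        mul_le_mul_of_nonneg_right (hK _ (norm_nonneg s)) (Real.exp_pos _).le
    _ = K * Real.exp (-(1 / 4) * ‖s‖ ^ 2) := by
        rw [mul_assoc, ← Real.exp_add]; congr 2; ring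

lemma Bconst_pos (N : ℕ) {β : ℝ} (hβ : 0 < β) : 0 < Bconst N β :=
  integral_exp_pos (integrable_exp_neg_mul_sq_norm volume hβ)

lemma Bconst_eq_mul (N : ℕ) {β : ℝ} (hβ : 0 < β) :
    Bconst N β = |((√β) ^ Module.finrank ℝ (ZZ N))⁻¹| * Bconst N 1 := by
  have h := Measure.integral_comp_smul (volume : Measure (ZZ N))
    (fun s => Real.exp (-1 * ‖s‖ ^ 2)) (√β)
  rw [smul_eq_mul] at h
  rw [Bconst, Bconst, ← h]
  congr 1 with s
  rw [norm_smul, mul_pow, Real.norm_of_nonneg (Real.sqrt_nonneg β), Real.sq_sqrt hβ.le]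
  congr 1
  ring

/-- The weighted first moment of the normalized Gaussian of inverse temperature `β` decays
like `β ^ (-1/2)`. -/
lemma exists_lintegral_gaussian_moment_le (N : ℕ) (β₀ : ℝ) {γ : ℝ} (hγ : 0 ≤ γ) :
    ∃ M : ℝ, 0 ≤ M ∧ ∀ β : ℝ, 1 ≤ β → 2 * β₀ ≤ β →
      ∫⁻ ζ : ZZ N, ENNReal.ofReal ((Bconst N β)⁻¹ * Real.exp (-β * ‖ζ‖ ^ 2) *
        (‖ζ‖ * (1 + ‖ζ‖ ^ γ) * Real.exp (β₀ * ‖ζ‖ ^ 2))) ≤ ENNReal.ofReal (M / √β) := by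
  set H : ZZ N → ℝ := fun s => ‖s‖ * (1 + ‖s‖ ^ γ) * Real.exp (-‖s‖ ^ 2 / 2) with hH
  have hHint : Integrable H := integrable_mul_one_add_rpow_mul_exp hγ
  have hH0 : ∀ s, 0 ≤ H s := fun s => by positivity
  have hB1 := Bconst_pos N one_pos
  refine ⟨(Bconst N 1)⁻¹ * ∫ s, H s,
    mul_nonneg (inv_nonneg.2 hB1.le) (integral_nonneg hH0), fun β hβ1 hβ2 => ?_⟩
  have hβ : 0 < β := one_pos.trans_le hβ1
  have hs1 : 1 ≤ √β := Real.one_le_sqrt.2 hβ1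
  have hs0 : 0 < √β := one_pos.trans_le hs1
  have hB := Bconst_pos N hβ
  have hcomp : Integrable (fun ζ => (Bconst N β)⁻¹ * (1 / √β) * H (√β • ζ)) :=
    (hHint.comp_smul hs0.ne').const_mul _
  calc _ ≤ ∫⁻ ζ : ZZ N, ENNReal.ofReal ((Bconst N β)⁻¹ * (1 / √β) * H (√β • ζ)) := by
        refine lintegral_mono fun ζ => ENNReal.ofReal_le_ofReal ?_
        have hn : ‖√β • ζ‖ = √β * ‖ζ‖ := by
          rw [norm_smul, Real.norm_of_nonneg hs0.le]
        have hle : ‖ζ‖ ≤ ‖√β • ζ‖ := by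
          rw [hn]; exact le_mul_of_one_le_left (norm_nonneg _) hs1
        have hexp : Real.exp (-β * ‖ζ‖ ^ 2) * Real.exp (β₀ * ‖ζ‖ ^ 2)
            ≤ Real.exp (-‖√β • ζ‖ ^ 2 / 2) := by
          rw [← Real.exp_add, hn, mul_pow, Real.sq_sqrt hβ.le]
          exact Real.exp_le_exp.2 (by nlinarith [sq_nonneg ‖ζ‖])
        have hx : ‖ζ‖ = 1 / √β * ‖√β • ζ‖ := by
          rw [hn]; field_simp
        calc (Bconst N β)⁻¹ * Real.exp (-β * ‖ζ‖ ^ 2) *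
              (‖ζ‖ * (1 + ‖ζ‖ ^ γ) * Real.exp (β₀ * ‖ζ‖ ^ 2))
            = (Bconst N β)⁻¹ * (‖ζ‖ * (1 + ‖ζ‖ ^ γ) *
              (Real.exp (-β * ‖ζ‖ ^ 2) * Real.exp (β₀ * ‖ζ‖ ^ 2))) := by ring
          _ ≤ (Bconst N β)⁻¹ * (‖ζ‖ * (1 + ‖√β • ζ‖ ^ γ) *
              Real.exp (-‖√β • ζ‖ ^ 2 / 2)) := by gcongr
          _ = (Bconst N β)⁻¹ * (1 / √β * ‖√β • ζ‖ * (1 + ‖√β • ζ‖ ^ γ) *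
              Real.exp (-‖√β • ζ‖ ^ 2 / 2)) := by rw [← hx]
          _ = _ := by rw [hH]; ring
    _ = ENNReal.ofReal (∫ ζ : ZZ N, (Bconst N β)⁻¹ * (1 / √β) * H (√β • ζ)) :=
        (ofReal_integral_eq_lintegral_ofReal hcomp
          (ae_of_all _ fun ζ => mul_nonneg (by positivity) (hH0 _))).symm
    _ ≤ _ := by
        refine ENNReal.ofReal_le_ofReal (le_of_eq ?_)
        rw [integral_const_mul, Measure.integral_comp_smul, smul_eq_mul, Bconst_eq_mul N hβ]
        have : |((√β) ^ Module.finrank ℝ (ZZ N))⁻¹| ≠ 0 := by positivity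
        field_simp

lemma abs_exp_neg_sub_exp_neg_le {N : ℕ} {E : AffineSubspace ℝ (ZZ N)} {Φ : ZZ N → ℝ}
    {β₀ c b : ℝ} (hβ₀ : 0 < β₀) (hc : 0 < c)
    (htrans : ∀ y : ZZ N, ∀ z ∈ E, c * (‖y‖ ^ 2 + ‖z‖ ^ 2) - b ≤ β₀ * ‖y - z‖ ^ 2 + Φ y)
    {ξ : ZZ N} (hξ : ξ ∈ E) (hC1 : ContDiff ℝ 1 (fun η : E.directionᗮ => Φ (ξ + η)))
    {C γ uξ : ℝ} (hC : 0 < C) (hγ : 0 ≤ γ)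
    (hgrowth : ∀ η : E.directionᗮ,
        ‖fderiv ℝ (fun η' : E.directionᗮ => Φ (ξ + η')) η‖ ≤ C * (1 + uξ + ‖η‖ ^ γ))
    (η : E.directionᗮ) :
    |Real.exp (-Φ (ξ + η)) - Real.exp (-Φ ξ)| ≤
      Real.exp (b + β₀ * ‖η‖ ^ 2 - c * ‖ξ‖ ^ 2) * (C * (1 + uξ + ‖η‖ ^ γ)) * ‖η‖ := by
  have hd : Differentiable ℝ (fun η : E.directionᗮ => Φ (ξ + η)) :=
    hC1.differentiable one_ne_zero
  have h := (convex_closedBall (0 : E.directionᗮ) ‖η‖).norm_image_sub_le_of_norm_fderiv_le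
    (𝕜 := ℝ) (f := fun η : E.directionᗮ => Real.exp (-Φ (ξ + η)))
    (C := Real.exp (b + β₀ * ‖η‖ ^ 2 - c * ‖ξ‖ ^ 2) * (C * (1 + uξ + ‖η‖ ^ γ)))
    (x := 0) (y := η) (fun x _ => (hd x).neg.exp) (fun x hx => ?_) (by simp) (by simp)
  · simpa using h
  · have hx' : ‖x‖ ≤ ‖η‖ := by simpa using hx
    rw [fderiv_exp (hd x).fun_neg, norm_smul, fderiv_fun_neg, norm_neg,
      Real.norm_of_nonneg (Real.exp_pos _).le]
    have ht := htrans (ξ + x) ξ hξ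
    rw [add_sub_cancel_left] at ht
    have hx2 : ‖(x : ZZ N)‖ ^ 2 ≤ ‖η‖ ^ 2 := pow_le_pow_left₀ (norm_nonneg _) hx' 2
    gcongr
    · nlinarith [sq_nonneg ‖ξ + (x : ZZ N)‖]
    · exact (hgrowth x).trans (by gcongr)

lemma abs_weighted_sub_le {N : ℕ} {E : AffineSubspace ℝ (ZZ N)} {ℓ : ℝ} (hℓ : 0 < ℓ)
    {Φ : ZZ N → ℝ} {β₀ c b : ℝ} (hβ₀ : 0 < β₀) (hc : 0 < c)
    (htrans : ∀ y : ZZ N, ∀ z ∈ E, c * (‖y‖ ^ 2 + ‖z‖ ^ 2) - b ≤ β₀ * ‖y - z‖ ^ 2 + Φ y)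
    {ξ : ZZ N} (hξ : ξ ∈ E) (hC1 : ContDiff ℝ 1 (fun η : E.directionᗮ => Φ (ξ + η)))
    {C γ uξ : ℝ} (hC : 0 < C) (hγ : 0 ≤ γ) (hu : 0 ≤ uξ)
    (hgrowth : ∀ η : E.directionᗮ,
        ‖fderiv ℝ (fun η' : E.directionᗮ => Φ (ξ + η')) η‖ ≤ C * (1 + uξ + ‖η‖ ^ γ))
    {f : ZZ N × ZZ N → ℝ} (hf1 : ∀ q, |f q| ≤ 1) (hfL : LipschitzWith (Real.toNNReal ℓ)⁻¹ f)
    (ζ : ZZ N) :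
    |f (ξ + (E.directionᗮ.orthogonalProjectionOnto ζ : ZZ N),
          ξ - (E.direction.orthogonalProjectionOnto ζ : ZZ N)) *
        Real.exp (-Φ (ξ + (E.directionᗮ.orthogonalProjectionOnto ζ : ZZ N))) -
        f (ξ, ξ) * Real.exp (-Φ ξ)| ≤
      ‖ζ‖ * (1 + ‖ζ‖ ^ γ) * Real.exp (β₀ * ‖ζ‖ ^ 2) *
        (Real.exp b * (1 / ℓ + C) * ((1 + uξ) * Real.exp (-c * ‖ξ‖ ^ 2 / 4))) := by
  set η := E.directionᗮ.orthogonalProjectionOnto ζ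
  set v := E.direction.orthogonalProjectionOnto ζ
  have hη : ‖η‖ ≤ ‖ζ‖ := E.directionᗮ.norm_orthogonalProjectionOnto_apply_le ζ
  have hv : ‖v‖ ≤ ‖ζ‖ := E.direction.norm_orthogonalProjectionOnto_apply_le ζ
  have hf : |f (ξ + η, ξ - v) - f (ξ, ξ)| ≤ 1 / ℓ * ‖ζ‖ := by
    have h := hfL.dist_le_mul (ξ + (η : ZZ N), ξ - (v : ZZ N)) (ξ, ξ)
    rw [Real.dist_eq, Prod.dist_eq, dist_eq_norm, dist_eq_norm, NNReal.coe_inv,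
      Real.coe_toNNReal _ hℓ.le, inv_eq_one_div] at h
    refine h.trans (mul_le_mul_of_nonneg_left (max_le ?_ ?_) (by positivity))
    · simpa using hη
    · simpa using hv
  have hΦξ : Real.exp (-Φ ξ) ≤ Real.exp b * Real.exp (-c * ‖ξ‖ ^ 2 / 4) := by
    rw [← Real.exp_add]
    have := htrans ξ ξ hξ
    rw [sub_self, norm_zero] at this
    exact Real.exp_le_exp.2 (by nlinarith [sq_nonneg ‖ξ‖])
  have hdiff : |Real.exp (-Φ (ξ + η)) - Real.exp (-Φ ξ)| ≤ Real.exp b *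
      Real.exp (β₀ * ‖ζ‖ ^ 2) * Real.exp (-c * ‖ξ‖ ^ 2 / 4) *
      (C * ((1 + ‖ζ‖ ^ γ) * (1 + uξ))) * ‖ζ‖ := by
    refine (abs_exp_neg_sub_exp_neg_le hβ₀ hc htrans hξ hC1 hC hγ hgrowth η).trans ?_
    rw [← Real.exp_add, ← Real.exp_add]
    have hp : 0 ≤ ‖ζ‖ ^ γ := by positivity
    have hp' : ‖η‖ ^ γ ≤ ‖ζ‖ ^ γ := by gcongr
    have hsq : ‖η‖ ^ 2 ≤ ‖ζ‖ ^ 2 := by gcongr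
    gcongr
    · nlinarith [sq_nonneg ‖ξ‖]
    · nlinarith [mul_nonneg hp hu]
  set x := ‖ζ‖
  have hx : 0 ≤ x := norm_nonneg ζ
  set e := Real.exp b * Real.exp (-c * ‖ξ‖ ^ 2 / 4) with he
  have hxγ : 0 ≤ x ^ γ := by positivity
  have h1 : 1 ≤ Real.exp (β₀ * x ^ 2) := Real.one_le_exp (by positivity)
  have h2 : 1 ≤ (1 + x ^ γ) * Real.exp (β₀ * x ^ 2) * (1 + uξ) :=
    one_le_mul_of_one_le_of_one_le (one_le_mul_of_one_le_of_one_le (by linarith) h1) (by linarith)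
  calc _ = |f (ξ + η, ξ - v) * (Real.exp (-Φ (ξ + η)) - Real.exp (-Φ ξ)) +
          (f (ξ + η, ξ - v) - f (ξ, ξ)) * Real.exp (-Φ ξ)| := by congr 1; ring
    _ ≤ |f (ξ + η, ξ - v)| * |Real.exp (-Φ (ξ + η)) - Real.exp (-Φ ξ)| +
          |f (ξ + η, ξ - v) - f (ξ, ξ)| * Real.exp (-Φ ξ) := by
        refine (abs_add_le _ _).trans (le_of_eq ?_)
        rw [abs_mul, abs_mul, abs_of_pos (Real.exp_pos (-Φ ξ))]
    _ ≤ 1 * (Real.exp b * Real.exp (β₀ * x ^ 2) * Real.exp (-c * ‖ξ‖ ^ 2 / 4) *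
          (C * ((1 + x ^ γ) * (1 + uξ))) * x) + 1 / ℓ * x * e := by
        gcongr
        exact hf1 _
    _ ≤ 1 * (Real.exp b * Real.exp (β₀ * x ^ 2) * Real.exp (-c * ‖ξ‖ ^ 2 / 4) *
          (C * ((1 + x ^ γ) * (1 + uξ))) * x) +
          1 / ℓ * x * e * ((1 + x ^ γ) * Real.exp (β₀ * x ^ 2) * (1 + uξ)) := by
        exact add_le_add_right (le_mul_of_one_le_right (by positivity) h2) _
    _ = _ := by rw [he]; ring

lemma integral_therm {N : ℕ} {E : AffineSubspace ℝ (ZZ N)} [SFinite (muE N E)]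
    {Φ : ZZ N → ℝ} (hΦ : Measurable Φ) {β : ℝ} (hβ : 0 < β) (f : ZZ N × ZZ N → ℝ) :
    ∫ q, f q ∂(therm ((muD N Φ).prod (muE N E)) β) =
      ∫ q, (Bconst N β)⁻¹ * Real.exp (-β * ‖q.1 - q.2‖ ^ 2) * (f q * Real.exp (-Φ q.1))
        ∂(volume.prod (muE N E)) := by
  have hB := Bconst_pos N hβ
  rw [therm, muD, prod_withDensity_left (by fun_prop),
    integral_withDensity_eq_integral_toReal_smul (by fun_prop) (by simp),
    integral_withDensity_eq_integral_toReal_smul (by fun_prop) (by simp)]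
  congr 1 with q
  rw [ENNReal.toReal_ofReal (by positivity), ENNReal.toReal_ofReal (by positivity),
    smul_eq_mul, smul_eq_mul]
  ring

lemma lintegral_weight_lt_top {N : ℕ} {E : AffineSubspace ℝ (ZZ N)}
    (hE : (E : Set (ZZ N)).Nonempty) (hdim : Module.finrank ℝ E.direction = N)
    {c : ℝ} (hc : 0 < c) {u : ZZ N → ℝ}
    (huint : ∫⁻ ξ, ENNReal.ofReal (u ξ * Real.exp (-c * ‖ξ‖ ^ 2 / 4)) ∂(muE N E) < ⊤) (A : ℝ)
    (hA : 0 ≤ A) :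
    ∫⁻ ξ, ENNReal.ofReal (A * ((1 + u ξ) * Real.exp (-c * ‖ξ‖ ^ 2 / 4))) ∂(muE N E) < ⊤ := by
  have hgauss : Integrable (fun z : ZZ N => Real.exp (-c * ‖z‖ ^ 2 / 4)) (muE N E) := by
    convert integrable_exp_neg_mul_sq_norm_muE hE hdim (a := c / 4) (by positivity) using 3
    ring
  calc _ ≤ ∫⁻ ξ, ENNReal.ofReal A * (ENNReal.ofReal (Real.exp (-c * ‖ξ‖ ^ 2 / 4)) +
          ENNReal.ofReal (u ξ * Real.exp (-c * ‖ξ‖ ^ 2 / 4))) ∂(muE N E) := by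
        refine lintegral_mono fun ξ => ?_
        rw [ENNReal.ofReal_mul hA]
        gcongr
        rw [add_mul, one_mul]
        exact ENNReal.ofReal_add_le
    _ < ⊤ := by
        rw [lintegral_const_mul' _ _ ENNReal.ofReal_ne_top, lintegral_add_left (by fun_prop)]
        exact ENNReal.mul_lt_top ENNReal.ofReal_lt_top
          (ENNReal.add_lt_top.2 ⟨hgauss.lintegral_lt_top, huint⟩)

/-!
STATEMENT 7: Under the hypotheses of the strong transversality result for sub-Gaussian
measures, there is `C₁ > 0` such that for all sufficiently large `β`,
`‖μ_β − μ_∞‖_FN ≤ C₁ β^{−1/2}`, where `μ_∞` is the diagonal concentration defined by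
`∫ f dμ_∞ = ∫_E f(ξ,ξ) e^{−Φ(ξ)} dH^N(ξ)`. The flat norm is expressed via its defining
supremum: for every `f` with `‖f‖_∞ ≤ 1` and `ℓ·Lip(f) ≤ 1` the difference of the
integrals is at most `C₁ β^{−1/2}`.
-/

theorem subGaussian_flat_norm_rate
    (N : ℕ) (E : AffineSubspace ℝ (ZZ N)) (hE : (E : Set (ZZ N)).Nonempty)
    (hdim : Module.finrank ℝ E.direction = N)
    (ℓ : ℝ) (hℓ : 0 < ℓ)
    (Φ : ZZ N → ℝ) (hΦ : Measurable Φ)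
    (β₀ c b : ℝ) (hβ₀ : 0 < β₀) (hc : 0 < c) (hb : 0 < b)
    (htrans : ∀ y : ZZ N, ∀ z ∈ E, c * (‖y‖ ^ 2 + ‖z‖ ^ 2) - b ≤ β₀ * ‖y - z‖ ^ 2 + Φ y)
    (hC1 : ∀ ξ ∈ E, ContDiff ℝ 1 (fun η : E.directionᗮ => Φ (ξ + η)))
    (C : ℝ) (hC : 0 < C) (γ : ℝ) (hγ : 0 ≤ γ)
    (u : ZZ N → ℝ) (hu : ∀ ξ ∈ E, 0 ≤ u ξ)
    (huint : ∫⁻ ξ in (E : Set (ZZ N)),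
        ENNReal.ofReal (u ξ * Real.exp (-c * ‖ξ‖ ^ 2 / 4)) ∂(μH[(N : ℝ)]) < ⊤)
    (hgrowth : ∀ ξ ∈ E, ∀ η : E.directionᗮ,
        ‖fderiv ℝ (fun η' : E.directionᗮ => Φ (ξ + η')) η‖ ≤ C * (1 + u ξ + ‖η‖ ^ γ)) :
    ∃ C₁ : ℝ, 0 < C₁ ∧ ∃ β₁ : ℝ, ∀ β : ℝ, β₁ ≤ β →
      ∀ f : ZZ N × ZZ N → ℝ, (∀ q, |f q| ≤ 1) →
        LipschitzWith (Real.toNNReal ℓ)⁻¹ f →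
        (∫ q, f q ∂(therm ((muD N Φ).prod (muE N E)) β)) -
          (∫ ξ in (E : Set (ZZ N)), f (ξ, ξ) * Real.exp (-Φ ξ) ∂(μH[(N : ℝ)]))
          ≤ C₁ / Real.sqrt β := by
  have := sFinite_muE hE hdim
  have hEmeas : MeasurableSet (E : Set (ZZ N)) := E.closed_of_finiteDimensional.measurableSet
  set A := Real.exp b * (1 / ℓ + C)
  set J := ∫⁻ ξ, ENNReal.ofReal (A * ((1 + u ξ) * Real.exp (-c * ‖ξ‖ ^ 2 / 4))) ∂(muE N E)
  have hJ : J < ⊤ := lintegral_weight_lt_top hE hdim hc huint A (by positivity)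
  obtain ⟨M, hM, hmoment⟩ := exists_lintegral_gaussian_moment_le N β₀ hγ
  refine ⟨M * J.toReal + 1, by positivity, max 1 (2 * β₀), fun β hβ f hf1 hfL => ?_⟩
  have hβ1 : 1 ≤ β := (le_max_left _ _).trans hβ
  have hβpos : 0 < β := one_pos.trans_le hβ1
  have hB := Bconst_pos N hβpos
  have hfm : Measurable f := hfL.continuous.measurable
  have hT := measurePreserving_shear hE hdim
  set T : ZZ N × ZZ N → ZZ N × ZZ N := fun q =>
    (q.2 + (E.directionᗮ.orthogonalProjectionOnto q.1 : ZZ N),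
      q.2 - (E.direction.orthogonalProjectionOnto q.1 : ZZ N))
  set G : ZZ N → ℝ := fun ζ => (Bconst N β)⁻¹ * Real.exp (-β * ‖ζ‖ ^ 2) with hG
  have hG0 : ∀ ζ, 0 ≤ G ζ := fun ζ => by positivity
  have hGm : Measurable G := by fun_prop
  have hGint : Integrable G := (integrable_exp_neg_mul_sq_norm volume hβpos).const_mul _
  have hG1 : ∫ ζ, G ζ = 1 := by
    rw [hG, integral_const_mul]
    exact inv_mul_cancel₀ hB.ne'
  set H₁ : ZZ N × ZZ N → ℝ := fun q => G q.1 * (f (T q) * Real.exp (-Φ (T q).1))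
  set H₂ : ZZ N × ZZ N → ℝ := fun q => G q.1 * (f (q.2, q.2) * Real.exp (-Φ q.2))
  have hTm : Measurable T := hT.measurable
  have hH₁m : Measurable H₁ := by fun_prop
  have hH₂m : Measurable H₂ := by fun_prop
  have hdiff : ∫⁻ q, ‖H₁ q - H₂ q‖ₑ ∂(volume.prod (muE N E)) ≤ ENNReal.ofReal (M / √β) * J := by
    rw [lintegral_prod _ (by fun_prop)]
    calc _ ≤ ∫⁻ ζ, ∫⁻ ξ, ENNReal.ofReal (G ζ *
            (‖ζ‖ * (1 + ‖ζ‖ ^ γ) * Real.exp (β₀ * ‖ζ‖ ^ 2))) *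
            ENNReal.ofReal (A * ((1 + u ξ) * Real.exp (-c * ‖ξ‖ ^ 2 / 4))) ∂(muE N E) := by
          refine lintegral_mono fun ζ => lintegral_mono_ae ?_
          filter_upwards [ae_restrict_mem hEmeas] with ξ hξ
          have h := abs_weighted_sub_le hℓ hβ₀ hc htrans hξ (hC1 ξ hξ) hC hγ (hu ξ hξ)
            (hgrowth ξ hξ) hf1 hfL ζ
          have := hG0 ζ
          rw [← ENNReal.ofReal_mul (by positivity), Real.enorm_eq_ofReal_abs, ← mul_sub,
            abs_mul, abs_of_nonneg (hG0 ζ), mul_assoc (G ζ)]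
          gcongr
      _ = ∫⁻ ζ, ENNReal.ofReal (G ζ *
            (‖ζ‖ * (1 + ‖ζ‖ ^ γ) * Real.exp (β₀ * ‖ζ‖ ^ 2))) * J := by
          congr 1 with ζ
          rw [lintegral_const_mul' _ _ ENNReal.ofReal_ne_top]
      _ ≤ _ := by
          rw [lintegral_mul_const' _ _ hJ.ne]
          gcongr
          exact hmoment β hβ1 ((le_max_right _ _).trans hβ)
  have hbound : ENNReal.ofReal (M / √β) * J < ⊤ := ENNReal.mul_lt_top ENNReal.ofReal_lt_top hJ
  have hlim : Integrable (fun ξ => f (ξ, ξ) * Real.exp (-Φ ξ)) (muE N E) := by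
    refine ((integrable_exp_neg_mul_sq_norm_muE hE hdim hc).const_mul (Real.exp b)).mono'
      (by fun_prop) ?_
    filter_upwards [ae_restrict_mem hEmeas] with ξ hξ
    rw [norm_mul, Real.norm_of_nonneg (Real.exp_pos _).le, ← Real.exp_add]
    refine (mul_le_of_le_one_left (Real.exp_pos _).le (hf1 _)).trans (Real.exp_le_exp.2 ?_)
    have := htrans ξ ξ hξ
    rw [sub_self, norm_zero] at this
    nlinarith [sq_nonneg ‖ξ‖]
  have hH₂ : Integrable H₂ (volume.prod (muE N E)) := hGint.mul_prod hlim
  have hsub : Integrable (fun q => H₁ q - H₂ q) (volume.prod (muE N E)) :=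
    ⟨by fun_prop, hdiff.trans_lt hbound⟩
  have hH₁ : Integrable H₁ (volume.prod (muE N E)) :=
    (hsub.add hH₂).congr (ae_of_all _ fun q => sub_add_cancel _ _)
  have hint₁ : ∫ q, f q ∂(therm ((muD N Φ).prod (muE N E)) β) =
      ∫ q, H₁ q ∂(volume.prod (muE N E)) := by
    rw [integral_therm hΦ hβpos]
    conv_lhs => rw [← hT.map_eq]
    rw [integral_map hTm.aemeasurable (by fun_prop)]
    congr 1 with q
    have h := E.direction.starProjection_add_starProjection_orthogonal q.1
    simp only [Submodule.starProjection_apply] at h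
    have hTsub : (T q).1 - (T q).2 = q.1 := by
      conv_rhs => rw [← h]
      simp only [T]
      abel
    rw [hTsub]
  have hint₂ : ∫ ξ in (E : Set (ZZ N)), f (ξ, ξ) * Real.exp (-Φ ξ) ∂(μH[(N : ℝ)]) =
      ∫ q, H₂ q ∂(volume.prod (muE N E)) := by
    rw [integral_prod_mul G (fun ξ => f (ξ, ξ) * Real.exp (-Φ ξ)), hG1, one_mul, muE]
  rw [hint₁, hint₂, ← integral_sub hH₁ hH₂]
  have hnorm : ‖∫ q, (H₁ q - H₂ q) ∂(volume.prod (muE N E))‖ ≤ M / √β * J.toReal := by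
    have h := (enorm_integral_le_lintegral_enorm _).trans hdiff
    have h' := ENNReal.toReal_mono hbound.ne h
    rwa [toReal_enorm, ENNReal.toReal_mul, ENNReal.toReal_ofReal (by positivity)] at h'
  calc _ ≤ M / √β * J.toReal := (Real.le_norm_self _).trans hnorm
    _ = M * J.toReal / √β := by ring
    _ ≤ _ := by gcongr; linarith
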